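/- arXiv:1601.01766 — 2 statements merged into one kernel-verified Lean document; each statement's English description precedes it below -/
import Mathlib

section
/- Weighted gradient integrability of the standard bubble, supercritical weight (inequality (3.6), case σ > n−2s): Let σ > n−2s. There exists a constant C > 0 such that for every R ≥ 2: ∫∫_{{(x,y): |x| ≥ 1, y > 0, |x|² + y² ≤ R²}} y^{1−2s} |x|^σ |∇_x w₁(x,y)|² dx dy ≤ C R^{σ−(n−2s)}, where ∇_x denotes the gradient in the x variables only. -/
open MeasureTheory Filter Set Topology

noncomputable section

abbrev Euc (n : ℕ) := EuclideanSpace ℝ (Fin n)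

/-- Partial derivative of `w` in the `i`-th horizontal direction. -/
noncomputable def pdX (n : ℕ) (w : Euc n → ℝ → ℝ) (i : Fin n) (x : Euc n) (y : ℝ) : ℝ :=
  fderiv ℝ (fun x' => w x' y) x (EuclideanSpace.single i 1)

/-- Partial derivative of `w` in the vertical direction. -/
noncomputable def pdY (n : ℕ) (w : Euc n → ℝ → ℝ) (x : Euc n) (y : ℝ) : ℝ :=
  deriv (fun y' => w x y') y

/-- `(∇ₓ w)ᵀ M (∇ₓ w)`. -/
noncomputable def quadA (n : ℕ) (M : Matrix (Fin n) (Fin n) ℝ) (w : Euc n → ℝ → ℝ)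
    (x : Euc n) (y : ℝ) : ℝ :=
  ∑ i, ∑ j, M i j * pdX n w i x y * pdX n w j x y

/-- `(∇ w)ᵀ diag(M,1) (∇ w)`. -/
noncomputable def quadB (n : ℕ) (M : Matrix (Fin n) (Fin n) ℝ) (w : Euc n → ℝ → ℝ)
    (x : Euc n) (y : ℝ) : ℝ :=
  quadA n M w x y + (pdY n w x y) ^ 2

/-- The standard bubble `u₁`. -/
noncomputable def u1 (n : ℕ) (s : ℝ) (ξ : Euc n) : ℝ :=
  (1 + ‖ξ‖ ^ 2) ^ (-(((n:ℝ) - 2*s) / 2))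

/-- The `s`-harmonic extension `w₁` of `u₁`. -/
noncomputable def w1 (n : ℕ) (s cns : ℝ) (x : Euc n) (y : ℝ) : ℝ :=
  cns * y ^ (2*s) *
    ∫ ξ : Euc n, u1 n s ξ * (‖x - ξ‖ ^ 2 + y ^ 2) ^ (-(((n:ℝ) + 2*s) / 2))

/-- The rescaled bubble extension `w_ε`. -/
noncomputable def wEps (n : ℕ) (s cns ε : ℝ) (x : Euc n) (y : ℝ) : ℝ :=
  ε ^ ((2*s - (n:ℝ)) / 2) * w1 n s cns (ε⁻¹ • x) (y / ε)

/-- The unnormalised Poisson kernel. -/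
def PK (n : ℕ) (s y : ℝ) (z : Euc n) : ℝ := (‖z‖ ^ 2 + y ^ 2) ^ (-(((n:ℝ) + 2*s) / 2))

/-- The convolution integral. -/
def CI (n : ℕ) (s y : ℝ) (x : Euc n) : ℝ := ∫ ξ : Euc n, u1 n s ξ * PK n s y (x - ξ)

lemma w1_eq (n : ℕ) (s cns : ℝ) (x : Euc n) (y : ℝ) :
    w1 n s cns x y = cns * y ^ (2*s) * CI n s y x := rfl

lemma ball_rpow (n : ℕ) (hn : 1 ≤ n) (p : ℝ) (hp : -(n:ℝ) < p) :
    ∃ C > (0:ℝ), ∀ r : ℝ, 0 < r →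
      IntegrableOn (fun x : Euc n => ‖x‖ ^ p) (Metric.ball 0 r) ∧
      ∫ x in Metric.ball (0 : Euc n) r, ‖x‖ ^ p ≤ C * r ^ (p + n) := by
  have : Nonempty (Fin n) := ⟨⟨0, hn⟩⟩
  have : Nontrivial (Euc n) := inferInstance
  have hI : ∀ r : ℝ, 0 < r → IntegrableOn (fun x : Euc n => ‖x‖ ^ p) (Metric.ball 0 r) := by
    intro r hr
    rw [integrableOn_fun_norm_addHaar volume (f := fun t : ℝ => t ^ p)]
    have h1 : IntegrableOn (fun t : ℝ => t ^ (p + n - 1)) (Ioo 0 r) := by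
      rw [intervalIntegral.integrableOn_Ioo_rpow_iff hr]
      linarith
    refine h1.congr_fun ?_ measurableSet_Ioo
    intro t ht
    have ht0 : (0:ℝ) < t := ht.1
    simp only [finrank_euclideanSpace, Fintype.card_fin, smul_eq_mul]
    rw [← Real.rpow_natCast, ← Real.rpow_add ht0]
    congr 1
    rw [Nat.cast_sub hn]
    push_cast
    ring
  refine ⟨(∫ x in Metric.ball (0 : Euc n) 1, ‖x‖ ^ p) + 1, ?_, ?_⟩
  · have : 0 ≤ ∫ x in Metric.ball (0 : Euc n) 1, ‖x‖ ^ p := integral_nonneg fun x => by positivity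
    linarith
  · intro r hr
    refine ⟨hI r hr, ?_⟩
    have h := Measure.setIntegral_comp_smul_of_pos volume (fun x : Euc n => ‖x‖ ^ p)
      (Metric.ball 0 1) hr
    rw [smul_unitBall_of_pos hr] at h
    simp only [finrank_euclideanSpace, Fintype.card_fin, smul_eq_mul, norm_smul,
      Real.norm_eq_abs, abs_of_pos hr] at h
    have h2 : ∫ x in Metric.ball (0 : Euc n) 1, (r * ‖x‖) ^ p
        = r ^ p * ∫ x in Metric.ball (0 : Euc n) 1, ‖x‖ ^ p := by
      rw [← integral_const_mul]
      congr 1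
      ext x
      rw [Real.mul_rpow hr.le (norm_nonneg _)]
    rw [h2] at h
    have h3 : ∫ x in Metric.ball (0 : Euc n) r, ‖x‖ ^ p
        = r ^ (p + n) * ∫ x in Metric.ball (0 : Euc n) 1, ‖x‖ ^ p := by
      rw [Real.rpow_add hr, Real.rpow_natCast, mul_assoc, mul_left_comm, h]
      field_simp
    rw [h3]
    have : 0 < r ^ (p + n) := by positivity
    nlinarith

lemma inner_bound (s γ : ℝ) (hs : s < 1) (hγ : 2 - 2*s < γ) :
    ∃ C > (0:ℝ), ∀ a : ℝ, 0 < a →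
      ∫⁻ y in Ioi (0:ℝ), ENNReal.ofReal (y ^ (1 - 2*s) * (a^2 + y^2) ^ (-(γ/2)))
        ≤ ENNReal.ofReal (C * a ^ (2 - 2*s - γ)) := by
  have e1 : 0 < 2 - 2*s := by linarith
  have e2 : 0 < γ - (2 - 2*s) := by linarith
  refine ⟨1 / (2 - 2*s) + 1 / (γ - (2 - 2*s)), by positivity, ?_⟩
  intro a ha
  rw [← Ioc_union_Ioi_eq_Ioi ha.le]
  refine (lintegral_union_le _ _ _).trans ?_
  rw [add_mul, ENNReal.ofReal_add (by positivity) (by positivity)]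
  have sq_r : ∀ t : ℝ, 0 < t → (t^2) ^ (-(γ/2)) = t ^ (-γ) := by
    intro t ht
    rw [← Real.rpow_natCast, ← Real.rpow_mul ht.le]
    congr 1
    push_cast
    ring
  gcongr
  · have hint : IntegrableOn (fun y : ℝ => a ^ (-γ) * y ^ (1 - 2*s)) (Ioc 0 a) := by
      apply Integrable.const_mul
      have := (intervalIntegral.intervalIntegrable_rpow' (a := 0) (b := a) (r := 1 - 2*s)
        (by linarith))
      rwa [intervalIntegrable_iff_integrableOn_Ioc_of_le ha.le] at this
    calc _ ≤ ∫⁻ y in Ioc 0 a, ENNReal.ofReal (a ^ (-γ) * y ^ (1 - 2*s)) := by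
          refine setLIntegral_mono' measurableSet_Ioc ?_
          intro y hy
          have hy0 : 0 < y := hy.1
          apply ENNReal.ofReal_le_ofReal
          rw [mul_comm]
          gcongr
          rw [← sq_r a ha]
          apply Real.rpow_le_rpow_of_nonpos (by positivity) (by nlinarith) (by linarith)
      _ = ENNReal.ofReal (∫ y in Ioc 0 a, a ^ (-γ) * y ^ (1 - 2*s)) := by
          rw [ofReal_integral_eq_lintegral_ofReal hint]
          filter_upwards [ae_restrict_mem measurableSet_Ioc] with y hy
          have hy0 : 0 < y := hy.1
          positivity
      _ ≤ _ := by
          apply ENNReal.ofReal_le_ofReal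
          apply le_of_eq
          rw [integral_const_mul, ← intervalIntegral.integral_of_le ha.le,
            integral_rpow (Or.inl (by linarith)), Real.zero_rpow (by linarith),
            show 1 - 2*s + 1 = 2 - 2*s by ring, show 2 - 2*s - γ = -γ + (2 - 2*s) by ring,
            Real.rpow_add ha]
          ring
  · have hint : IntegrableOn (fun y : ℝ => y ^ (1 - 2*s - γ)) (Ioi a) :=
      integrableOn_Ioi_rpow_of_lt (by linarith) ha
    calc _ ≤ ∫⁻ y in Ioi a, ENNReal.ofReal (y ^ (1 - 2*s - γ)) := by
          refine setLIntegral_mono' measurableSet_Ioi ?_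
          intro y hy
          have hy0 : 0 < y := ha.trans hy
          apply ENNReal.ofReal_le_ofReal
          rw [show 1 - 2*s - γ = (1 - 2*s) + (-γ) by ring, Real.rpow_add hy0]
          gcongr
          rw [← sq_r y hy0]
          apply Real.rpow_le_rpow_of_nonpos (by positivity) (by nlinarith) (by linarith)
      _ = ENNReal.ofReal (∫ y in Ioi a, y ^ (1 - 2*s - γ)) := by
          rw [ofReal_integral_eq_lintegral_ofReal hint]
          filter_upwards [ae_restrict_mem measurableSet_Ioi] with y hy
          have hy0 : 0 < y := ha.trans hy
          positivity
      _ ≤ _ := by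
          apply ENNReal.ofReal_le_ofReal
          apply le_of_eq
          rw [integral_Ioi_rpow_of_lt (by linarith) ha,
            show 1 - 2*s - γ + 1 = 2 - 2*s - γ by ring,
            show γ - (2 - 2*s) = -(2 - 2*s - γ) by ring, neg_div, one_div, inv_neg]
          ring

/-- Right-sided comparison of derivatives. -/
lemma deriv_nonneg_of_right (h : ℝ → ℝ) (d : ℝ) (hd : HasDerivAt h d 0)
    (h0 : ∀ t > 0, h 0 ≤ h t) : 0 ≤ d := by
  have := (hd.hasDerivWithinAt (s := Ioi 0))
  rw [hasDerivWithinAt_iff_tendsto_slope' (by simp)] at this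
  refine ge_of_tendsto this ?_
  filter_upwards [self_mem_nhdsWithin] with t ht
  have ht : 0 < t := ht
  rw [slope_def_field]
  have := h0 t ht
  apply div_nonneg <;> linarith

lemma log_deriv_bound (φ : ℝ → ℝ) (d A b : ℝ) (hd : HasDerivAt φ d 0)
    (hlo : ∀ t > 0, (1 + b * t) ^ (-A) * φ 0 ≤ φ t)
    (hhi : ∀ t > 0, φ t ≤ (1 + b * t) ^ A * φ 0) : |d| ≤ A * b * φ 0 := by
  have key : ∀ B : ℝ, HasDerivAt (fun t : ℝ => (1 + b * t) ^ B * φ 0) (B * b * φ 0) 0 := by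
    intro B
    have h1 : HasDerivAt (fun t : ℝ => 1 + b * t) b 0 := by
      simpa using ((hasDerivAt_id (0:ℝ)).const_mul b).const_add 1
    have h2 := (h1.rpow_const (p := B) (Or.inl (by simp))).mul_const (φ 0)
    have e : b * B * (1 + b * 0) ^ (B - 1) * φ 0 = B * b * φ 0 := by
      rw [mul_zero, add_zero, Real.one_rpow]
      ring
    rwa [e] at h2
  rw [abs_le]
  constructor
  · have := deriv_nonneg_of_right _ _ (hd.sub (key (-A))) (by
      intro t ht
      have := hlo t ht
      simp
      linarith)
    linarith
  · have := deriv_nonneg_of_right _ _ ((key A).sub hd) (by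
      intro t ht
      have := hhi t ht
      simp
      linarith)
    linarith

lemma u1_pos (n : ℕ) (s : ℝ) (ξ : Euc n) : 0 < u1 n s ξ := by
  unfold u1
  positivity

lemma u1_le_one (n : ℕ) (s : ℝ) (hns : 2 * s < (n:ℝ)) (ξ : Euc n) : u1 n s ξ ≤ 1 := by
  unfold u1
  apply Real.rpow_le_one_of_one_le_of_nonpos
  · nlinarith [sq_nonneg ‖ξ‖]
  · linarith

lemma u1_cont (n : ℕ) (s : ℝ) : Continuous (u1 n s) := by
  unfold u1
  refine Continuous.rpow_const (by fun_prop) ?_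
  intro x
  left
  positivity

lemma PK_pos (n : ℕ) (s y : ℝ) (hy : 0 < y) (z : Euc n) : 0 < PK n s y z := by
  unfold PK
  positivity

lemma PK_integrable (n : ℕ) (s cns : ℝ)
    (hnorm : ∀ y : ℝ, 0 < y →
      cns * (∫ x : Euc n, y ^ (2*s) * (‖x‖ ^ 2 + y ^ 2) ^ (-(((n:ℝ) + 2*s) / 2))) = 1)
    (y : ℝ) (hy : 0 < y) : Integrable (PK n s y) := by
  by_contra hc
  have h := hnorm y hy
  rw [integral_const_mul] at h
  have : ∫ x : Euc n, (‖x‖ ^ 2 + y ^ 2) ^ (-(((n:ℝ) + 2*s) / 2)) = 0 := integral_undef hc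
  rw [this] at h
  simp at h

lemma CI_integrable (n : ℕ) (s : ℝ) (hns : 2 * s < (n:ℝ)) (y : ℝ)
    (hK : Integrable (PK n s y)) (x : Euc n) :
    Integrable (fun ξ => u1 n s ξ * PK n s y (x - ξ)) := by
  refine (hK.comp_sub_left x).bdd_mul (c := 1) (u1_cont n s).aestronglyMeasurable ?_
  filter_upwards with ξ
  rw [Real.norm_eq_abs, abs_of_pos (u1_pos n s ξ)]
  exact u1_le_one n s hns ξ

lemma CI_nonneg (n : ℕ) (s y : ℝ) (hy : 0 < y) (x : Euc n) : 0 ≤ CI n s y x :=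
  integral_nonneg fun ξ => (mul_pos (u1_pos n s ξ) (PK_pos n s y hy _)).le

/-- Generic comparison for negative powers of squares. -/
lemma pow_compare (a b l β : ℝ) (ha : 0 < a) (hb : 0 < b) (hl : 0 < l) (hβ : 0 ≤ β)
    (hab : b ≤ l ^ 2 * a) : l ^ (-(2*β)) * a ^ (-β) ≤ b ^ (-β) := by
  have : (l ^ 2 * a) ^ (-β) ≤ b ^ (-β) :=
    Real.rpow_le_rpow_of_nonpos hb hab (by linarith)
  refine le_trans (le_of_eq ?_) this
  rw [Real.mul_rpow (by positivity) ha.le, ← Real.rpow_natCast, ← Real.rpow_mul hl.le]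
  congr 2
  push_cast
  ring

lemma CI_translate (n : ℕ) (s : ℝ) (hs : 0 < s) (hns : 2 * s < (n:ℝ)) (y : ℝ) (hy : 0 < y)
    (hK : Integrable (PK n s y)) (x h : Euc n) :
    (1 + ‖h‖ / y) ^ (-((n:ℝ) + 2*s)) * CI n s y x ≤ CI n s y (x + h) := by
  unfold CI
  rw [← integral_const_mul]
  refine integral_mono ((CI_integrable n s hns y hK x).const_mul _)
    (CI_integrable n s hns y hK _) ?_
  intro ξ
  simp only
  rw [mul_left_comm]
  refine mul_le_mul_of_nonneg_left ?_ (u1_pos n s ξ).le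
  unfold PK
  have := pow_compare (‖x - ξ‖ ^ 2 + y ^ 2) (‖x + h - ξ‖ ^ 2 + y ^ 2) (1 + ‖h‖ / y)
    (((n:ℝ) + 2*s) / 2) (by positivity) (by positivity) (by positivity) (by positivity) ?_
  · rwa [mul_div_cancel₀ _ (two_ne_zero)] at this
  · have h1 : ‖x + h - ξ‖ ≤ ‖x - ξ‖ + ‖h‖ := by
      rw [show x + h - ξ = (x - ξ) + h by abel]
      exact norm_add_le _ _
    have h2 : ‖x + h - ξ‖ ^ 2 ≤ (‖x - ξ‖ + ‖h‖) ^ 2 := by gcongr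
    obtain ⟨t, ht⟩ : ∃ t, t = ‖h‖ / y := ⟨_, rfl⟩
    have ht0 : 0 ≤ t := by rw [ht]; positivity
    have hh : ‖h‖ = t * y := by rw [ht]; field_simp
    rw [← ht]
    rw [hh] at h2
    generalize ‖x - ξ‖ = q at *
    nlinarith [mul_nonneg ht0 (sq_nonneg (q - y)), mul_nonneg (mul_nonneg ht0 ht0) (sq_nonneg q)]

lemma CI_scale (n : ℕ) (s : ℝ) (y : ℝ) (x : Euc n) (l : ℝ) (hl : 0 < l) :
    CI n s y (l • x) = l ^ n * ∫ η : Euc n, u1 n s (l • η) * PK n s y (l • (x - η)) := by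
  have h := Measure.integral_comp_smul_of_nonneg volume
    (fun ξ : Euc n => u1 n s ξ * PK n s y (l • x - ξ)) l (hR := hl.le)
  simp only [finrank_euclideanSpace, Fintype.card_fin, smul_eq_mul, ← smul_sub] at h
  rw [h]
  unfold CI
  field_simp

lemma CI_scale_integrable (n : ℕ) (s : ℝ) (hns : 2 * s < (n:ℝ)) (y : ℝ)
    (hK : Integrable (PK n s y)) (x : Euc n) (l : ℝ) (hl : 0 < l) :
    Integrable (fun η : Euc n => u1 n s (l • η) * PK n s y (l • (x - η))) := by
  have := (CI_integrable n s hns y hK (l • x)).comp_smul hl.ne'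
  simpa only [← smul_sub] using this

lemma CI_scale_le (n : ℕ) (s : ℝ) (hs : 0 < s) (hns : 2 * s < (n:ℝ)) (y : ℝ) (hy : 0 < y)
    (hK : Integrable (PK n s y)) (x : Euc n) (l : ℝ) (hl : 1 ≤ l) :
    CI n s y (l • x) ≤ l ^ (n:ℝ) * CI n s y x := by
  have hl0 : 0 < l := by linarith
  rw [CI_scale n s y x l hl0, Real.rpow_natCast]
  refine mul_le_mul_of_nonneg_left ?_ (by positivity)
  refine integral_mono (CI_scale_integrable n s hns y hK x l hl0) (CI_integrable n s hns y hK x) ?_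
  intro η
  simp only
  have hz : ∀ z : Euc n, ‖z‖ ^ 2 ≤ ‖l • z‖ ^ 2 := by
    intro z
    rw [norm_smul, Real.norm_eq_abs, abs_of_pos hl0]
    gcongr
    exact le_mul_of_one_le_left (norm_nonneg _) hl
  refine mul_le_mul ?_ ?_ (PK_pos n s y hy _).le (u1_pos n s _).le
  · unfold u1
    refine Real.rpow_le_rpow_of_nonpos (by positivity) ?_ (by linarith)
    linarith [hz η]
  · unfold PK
    refine Real.rpow_le_rpow_of_nonpos (by positivity) ?_ (by linarith)
    linarith [hz (x - η)]

lemma CI_scale_ge (n : ℕ) (s : ℝ) (hs : 0 < s) (hns : 2 * s < (n:ℝ)) (y : ℝ) (hy : 0 < y)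
    (hK : Integrable (PK n s y)) (x : Euc n) (l : ℝ) (hl : 1 ≤ l) :
    l ^ (-(n:ℝ)) * CI n s y x ≤ CI n s y (l • x) := by
  have hl0 : 0 < l := by linarith
  have hl2 : 1 ≤ l ^ 2 := by nlinarith
  rw [CI_scale n s y x l hl0]
  have e : l ^ (-(n:ℝ)) * CI n s y x = l ^ n * (l ^ (-(2*(n:ℝ))) * CI n s y x) := by
    rw [← mul_assoc, ← Real.rpow_natCast, ← Real.rpow_add hl0]
    congr 2
    ring
  rw [e]
  refine mul_le_mul_of_nonneg_left ?_ (by positivity)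
  unfold CI
  rw [← integral_const_mul]
  refine integral_mono ((CI_integrable n s hns y hK x).const_mul _)
    (CI_scale_integrable n s hns y hK x l hl0) ?_
  intro η
  simp only
  have hz : ∀ z : Euc n, ‖l • z‖ ^ 2 = l ^ 2 * ‖z‖ ^ 2 := by
    intro z
    rw [norm_smul, Real.norm_eq_abs, abs_of_pos hl0]
    ring
  have h1 : l ^ (-(2*(((n:ℝ) - 2*s) / 2))) * u1 n s η ≤ u1 n s (l • η) := by
    unfold u1
    refine pow_compare _ _ _ _ (by positivity) (by positivity) hl0 (by linarith) ?_
    rw [hz]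
    nlinarith
  have h2 : l ^ (-(2*(((n:ℝ) + 2*s) / 2))) * PK n s y (x - η) ≤ PK n s y (l • (x - η)) := by
    unfold PK
    refine pow_compare _ _ _ _ (by positivity) (by positivity) hl0 (by positivity) ?_
    rw [hz]
    nlinarith [sq_nonneg y]
  have h3 := mul_le_mul h1 h2
    (mul_nonneg (by positivity) (PK_pos n s y hy _).le) (u1_pos n s _).le
  refine le_trans (le_of_eq ?_) h3
  rw [mul_mul_mul_comm, ← Real.rpow_add hl0]
  congr 2
  ring

lemma CI_isometry (n : ℕ) (s y : ℝ) (ρ : Euc n ≃ₗᵢ[ℝ] Euc n) (x : Euc n) :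
    CI n s y (ρ x) = CI n s y x := by
  unfold CI
  rw [← (ρ.measurePreserving).integral_comp ρ.toHomeomorph.measurableEmbedding]
  congr 1
  ext ξ
  unfold u1 PK
  rw [← map_sub, ρ.norm_map, ρ.norm_map]

lemma fderiv_orth (n : ℕ) (s y : ℝ) (x v : Euc n) (hv : inner ℝ v x = 0) :
    fderiv ℝ (CI n s y) x v = 0 := by
  let ρ := (ℝ ∙ v)ᗮ.reflection
  have h1 : ρ v = -v := Submodule.reflection_orthogonalComplement_singleton_eq_neg v
  have h2 : ρ x = x := by
    apply Submodule.reflection_mem_subspace_eq_self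
    rw [Submodule.mem_orthogonal_singleton_iff_inner_right]
    exact hv
  have h3 : (CI n s y) ∘ ρ = CI n s y := funext fun z => CI_isometry n s y ρ z
  have h4 := ρ.toContinuousLinearEquiv.comp_right_fderiv (f := CI n s y) (x := x)
  have h5 : (CI n s y) ∘ (ρ.toContinuousLinearEquiv) = CI n s y := h3
  rw [h5] at h4
  have h6 : fderiv ℝ (CI n s y) x v = fderiv ℝ (CI n s y) (ρ x) (ρ v) := by
    conv_lhs => rw [h4]
    rfl
  rw [h1, h2, map_neg] at h6
  linarith

lemma fderiv_bounds (n : ℕ) (s : ℝ) (hs : 0 < s) (hns : 2 * s < (n:ℝ)) (y : ℝ) (hy : 0 < y)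
    (hK : Integrable (PK n s y)) (x v : Euc n) :
    |fderiv ℝ (CI n s y) x v| ≤ ((n:ℝ) + 2*s) * (‖v‖ / y) * CI n s y x ∧
    |fderiv ℝ (CI n s y) x x| ≤ (n:ℝ) * CI n s y x := by
  have hC := CI_nonneg n s y hy x
  by_cases hdiff : DifferentiableAt ℝ (CI n s y) x
  swap
  · rw [fderiv_zero_of_not_differentiableAt hdiff]
    simp only [zero_apply, abs_zero]
    constructor <;> positivity
  have hD : ∀ v : Euc n, HasDerivAt (fun t : ℝ => CI n s y (x + t • v))
      (fderiv ℝ (CI n s y) x v) 0 := by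
    intro v
    exact hdiff.hasFDerivAt.hasLineDerivAt v
  constructor
  · have := log_deriv_bound _ _ ((n:ℝ) + 2*s) (‖v‖ / y) (hD v) ?_ ?_
    · simpa using this
    · intro t ht
      have := CI_translate n s hs hns y hy hK x (t • v)
      rw [norm_smul, Real.norm_eq_abs, abs_of_pos ht] at this
      rw [zero_smul, add_zero, show ‖v‖ / y * t = t * ‖v‖ / y by ring]
      exact this
    · intro t ht
      have := CI_translate n s hs hns y hy hK (x + t • v) (-(t • v))
      rw [norm_neg, norm_smul, Real.norm_eq_abs, abs_of_pos ht, add_neg_cancel_right] at this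
      rw [zero_smul, add_zero, show ‖v‖ / y * t = t * ‖v‖ / y by ring]
      have hp : 0 < 1 + t * ‖v‖ / y := by positivity
      rw [Real.rpow_neg hp.le] at this
      have hpp : 0 < (1 + t * ‖v‖ / y) ^ ((n:ℝ) + 2*s) := by positivity
      rwa [inv_mul_le_iff₀ hpp] at this
  · have := log_deriv_bound _ _ (n:ℝ) 1 (hD x) ?_ ?_
    · simpa using this
    · intro t ht
      have := CI_scale_ge n s hs hns y hy hK x (1 + t) (by linarith)
      rw [add_smul, one_smul] at this
      rwa [zero_smul, add_zero, one_mul]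
    · intro t ht
      have := CI_scale_le n s hs hns y hy hK x (1 + t) (by linarith)
      rw [add_smul, one_smul] at this
      rwa [zero_smul, add_zero, one_mul]

lemma fderiv_coord (n : ℕ) (s : ℝ) (hs : s ∈ Ioo (0:ℝ) 1) (hns : 2 * s < (n:ℝ)) (y : ℝ)
    (hy : 0 < y) (hK : Integrable (PK n s y)) (x : Euc n) (hx : x ≠ 0) (i : Fin n) :
    (fderiv ℝ (CI n s y) x (EuclideanSpace.single i 1)) ^ 2 ≤
      2 * ((n:ℝ) + 2) ^ 2 * (CI n s y x) ^ 2 / (‖x‖ ^ 2 + y ^ 2) := by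
  obtain ⟨hs0, hs1⟩ := hs
  set e : Euc n := EuclideanSpace.single i 1 with he
  have hne : ‖e‖ = 1 := by simp [he]
  have hxp : 0 < ‖x‖ := norm_pos_iff.mpr hx
  obtain ⟨hb1, hb2⟩ := fderiv_bounds n s hs0 hns y hy hK x e
  have hC := CI_nonneg n s y hy x
  set D := fderiv ℝ (CI n s y) x with hDdef
  set W := CI n s y x
  have ho := fderiv_orth n s y x (e - (inner ℝ e x / ‖x‖ ^ 2) • x) (by
    rw [inner_sub_left, inner_smul_left, real_inner_self_eq_norm_sq]
    simp
    field_simp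
    simp)
  rw [← hDdef, map_sub, map_smul, smul_eq_mul, sub_eq_zero] at ho
  have hin : |inner ℝ e x| ≤ ‖x‖ := by
    have := abs_real_inner_le_norm e x
    rwa [hne, one_mul] at this
  have h1 : |D e| * ‖x‖ ≤ ((n:ℝ) + 2) * W := by
    rw [ho, abs_mul, abs_div, abs_of_pos (show 0 < ‖x‖ ^ 2 by positivity)]
    have : |inner ℝ e x| / ‖x‖ ^ 2 * ‖x‖ ≤ 1 := by
      rw [div_mul_eq_mul_div, div_le_one (by positivity)]
      nlinarith
    calc _ = (|inner ℝ e x| / ‖x‖ ^ 2 * ‖x‖) * |D x| := by ring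
      _ ≤ 1 * |D x| := by gcongr
      _ ≤ _ := by nlinarith
  have h2 : |D e| * y ≤ ((n:ℝ) + 2) * W := by
    rw [hne] at hb1
    calc _ ≤ (((n:ℝ) + 2*s) * (1 / y) * W) * y := by gcongr
      _ = ((n:ℝ) + 2*s) * W := by field_simp
      _ ≤ _ := by gcongr; linarith
  rw [le_div_iff₀ (by positivity), ← sq_abs]
  have h3 : (|D e| * ‖x‖) ^ 2 ≤ (((n:ℝ) + 2) * W) ^ 2 := by gcongr
  have h4 : (|D e| * y) ^ 2 ≤ (((n:ℝ) + 2) * W) ^ 2 := by gcongr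
  nlinarith

lemma w1_upper (n : ℕ) (hn : 1 ≤ n) (s : ℝ) (hs : s ∈ Ioo (0:ℝ) 1) (hns : 2 * s < (n:ℝ))
    (cns : ℝ) (hcns : 0 < cns)
    (hnorm : ∀ y : ℝ, 0 < y →
      cns * (∫ x : Euc n, y ^ (2*s) * (‖x‖ ^ 2 + y ^ 2) ^ (-(((n:ℝ) + 2*s) / 2))) = 1) :
    ∃ C > (0:ℝ), ∀ (x : Euc n) (y : ℝ), 0 < y →
      w1 n s cns x y ≤ C * (‖x‖ ^ 2 + y ^ 2) ^ (-(((n:ℝ) - 2*s) / 2)) := by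
  obtain ⟨hs0, hs1⟩ := hs
  obtain ⟨C, hC, hball⟩ := ball_rpow n hn (-((n:ℝ) - 2*s)) (by linarith)
  refine ⟨(1 + cns * C * 2 ^ (2*s)) * (4:ℝ) ^ (((n:ℝ) - 2*s) / 2), by positivity, ?_⟩
  intro x y hy
  have hK := PK_integrable n s cns hnorm y hy
  obtain ⟨q, hq⟩ : ∃ q, q = Real.sqrt (‖x‖ ^ 2 + y ^ 2) / 2 := ⟨_, rfl⟩
  have hq0 : 0 < q := by rw [hq]; positivity
  have hq2 : ‖x‖ ^ 2 + y ^ 2 = 4 * q ^ 2 := by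
    rw [hq, div_pow, Real.sq_sqrt (by positivity)]
    ring
  have sqr : ∀ t b : ℝ, 0 < t → (t ^ 2) ^ (-(b/2)) = t ^ (-b) := by
    intro t b ht
    rw [← Real.rpow_natCast, ← Real.rpow_mul ht.le]
    congr 1
    push_cast
    ring
  have hyq : y ≤ 2 * q := by
    refine le_of_pow_le_pow_left₀ two_ne_zero (by positivity) ?_
    nlinarith [sq_nonneg ‖x‖]
  obtain ⟨hbi, hbb⟩ := hball q hq0
  have hpt : ∀ᵐ ξ : Euc n, u1 n s ξ * PK n s y (x - ξ) ≤
      q ^ (-((n:ℝ) - 2*s)) * PK n s y (x - ξ) + q ^ (-((n:ℝ) + 2*s)) *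
        (Metric.ball (0 : Euc n) q).indicator (fun ξ => ‖ξ‖ ^ (-((n:ℝ) - 2*s))) ξ := by
    have : Nonempty (Fin n) := ⟨⟨0, hn⟩⟩
    have : Nontrivial (Euc n) := inferInstance
    filter_upwards [Measure.ae_ne volume (0 : Euc n)] with ξ hξ
    have hξp : 0 < ‖ξ‖ := norm_pos_iff.mpr hξ
    have hu : u1 n s ξ ≤ ‖ξ‖ ^ (-((n:ℝ) - 2*s)) := by
      rw [← sqr _ _ hξp]
      unfold u1
      exact Real.rpow_le_rpow_of_nonpos (by positivity) (by linarith) (by linarith)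
    have hPK := PK_pos n s y hy (x - ξ)
    by_cases hb : ξ ∈ Metric.ball (0 : Euc n) q
    · rw [indicator_of_mem hb]
      have hξq : ‖ξ‖ < q := by simpa using hb
      have hP : PK n s y (x - ξ) ≤ q ^ (-((n:ℝ) + 2*s)) := by
        rw [← sqr _ _ hq0]
        unfold PK
        refine Real.rpow_le_rpow_of_nonpos (by positivity) ?_ (by linarith)
        have h1 : ‖x‖ ≤ ‖x - ξ‖ + ‖ξ‖ := by
          have := norm_add_le (x - ξ) ξ
          rwa [sub_add_cancel] at this
        by_contra hcon
        push Not at hcon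
        have h2 : ‖x - ξ‖ < q := by
          apply lt_of_pow_lt_pow_left₀ 2 hq0.le
          nlinarith [sq_nonneg y]
        have h3 : ‖x‖ ^ 2 ≤ (‖x - ξ‖ + ‖ξ‖) ^ 2 := by gcongr
        nlinarith [norm_nonneg (x - ξ), norm_nonneg ξ]
      have h4 : u1 n s ξ * PK n s y (x - ξ) ≤ ‖ξ‖ ^ (-((n:ℝ) - 2*s)) * q ^ (-((n:ℝ) + 2*s)) :=
        mul_le_mul hu hP hPK.le (by positivity)
      have h5 : 0 ≤ q ^ (-((n:ℝ) - 2*s)) * PK n s y (x - ξ) := by positivity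
      linarith
    · rw [indicator_of_notMem hb, mul_zero, add_zero]
      have hξq : q ≤ ‖ξ‖ := by simpa using hb
      refine mul_le_mul_of_nonneg_right (hu.trans ?_) hPK.le
      exact Real.rpow_le_rpow_of_nonpos hq0 hξq (by linarith)
  have hint1 : Integrable (fun ξ => q ^ (-((n:ℝ) - 2*s)) * PK n s y (x - ξ)) :=
    (hK.comp_sub_left x).const_mul _
  have hint2 : Integrable (fun ξ => q ^ (-((n:ℝ) + 2*s)) *
        (Metric.ball (0 : Euc n) q).indicator (fun ξ => ‖ξ‖ ^ (-((n:ℝ) - 2*s))) ξ) :=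
    (hbi.integrable_indicator Metric.isOpen_ball.measurableSet).const_mul _
  have hI : CI n s y x ≤ q ^ (-((n:ℝ) - 2*s)) * (∫ ξ, PK n s y ξ) +
      q ^ (-((n:ℝ) + 2*s)) * (C * q ^ (-((n:ℝ) - 2*s) + n)) := by
    refine (integral_mono_ae (CI_integrable n s hns y hK x) (hint1.add hint2) hpt).trans ?_
    rw [Pi.add_def, integral_add hint1 hint2, integral_const_mul, integral_const_mul,
      integral_sub_left_eq_self (PK n s y) volume x,
      integral_indicator Metric.isOpen_ball.measurableSet]
    gcongr
  have hJ : cns * y ^ (2*s) * (∫ ξ, PK n s y ξ) = 1 := by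
    have := hnorm y hy
    rw [integral_const_mul, ← mul_assoc] at this
    exact this
  have hyp : y ^ (2*s) ≤ 2 ^ (2*s) * q ^ (2*s) := by
    rw [← Real.mul_rpow (by norm_num) hq0.le]
    gcongr
  have hyp0 : 0 < y ^ (2*s) := by positivity
  have eq1 : q ^ (2*s) * (q ^ (-((n:ℝ) + 2*s)) * q ^ (-((n:ℝ) - 2*s) + n))
      = q ^ (-((n:ℝ) - 2*s)) := by
    rw [← Real.rpow_add hq0, ← Real.rpow_add hq0]
    congr 1
    ring
  have eq2 : (4:ℝ) ^ (((n:ℝ) - 2*s) / 2) * (‖x‖ ^ 2 + y ^ 2) ^ (-(((n:ℝ) - 2*s) / 2))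
      = q ^ (-((n:ℝ) - 2*s)) := by
    rw [hq2, Real.mul_rpow (by norm_num) (by positivity), sqr _ _ hq0, ← mul_assoc,
      ← Real.rpow_add (by norm_num), add_neg_cancel, Real.rpow_zero, one_mul]
  rw [mul_assoc, eq2, w1_eq]
  calc _ ≤ cns * y ^ (2*s) * (q ^ (-((n:ℝ) - 2*s)) * (∫ ξ, PK n s y ξ) +
      q ^ (-((n:ℝ) + 2*s)) * (C * q ^ (-((n:ℝ) - 2*s) + n))) := by gcongr
    _ = (cns * y ^ (2*s) * (∫ ξ, PK n s y ξ)) * q ^ (-((n:ℝ) - 2*s)) +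
      cns * C * (q ^ (-((n:ℝ) + 2*s)) * q ^ (-((n:ℝ) - 2*s) + n)) * y ^ (2*s) := by ring
    _ ≤ 1 * q ^ (-((n:ℝ) - 2*s)) +
      cns * C * (q ^ (-((n:ℝ) + 2*s)) * q ^ (-((n:ℝ) - 2*s) + n)) * (2 ^ (2*s) * q ^ (2*s)) := by
        rw [hJ]
        gcongr
    _ = 1 * q ^ (-((n:ℝ) - 2*s)) + cns * C * 2 ^ (2*s) *
      (q ^ (2*s) * (q ^ (-((n:ℝ) + 2*s)) * q ^ (-((n:ℝ) - 2*s) + n))) := by ring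
    _ = _ := by rw [eq1]; ring

lemma pointwise (n : ℕ) (hn : 1 ≤ n) (s : ℝ) (hs : s ∈ Ioo (0:ℝ) 1) (hns : 2 * s < (n:ℝ))
    (cns : ℝ) (hcns : 0 < cns)
    (hnorm : ∀ y : ℝ, 0 < y →
      cns * (∫ x : Euc n, y ^ (2*s) * (‖x‖ ^ 2 + y ^ 2) ^ (-(((n:ℝ) + 2*s) / 2))) = 1) :
    ∃ M > (0:ℝ), ∀ (x : Euc n) (y : ℝ), x ≠ 0 → 0 < y →
      ∑ i, (pdX n (w1 n s cns) i x y) ^ 2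
        ≤ M * (‖x‖ ^ 2 + y ^ 2) ^ (-((2 * ((n:ℝ) - 2*s) + 2) / 2)) := by
  obtain ⟨C, hC, hw⟩ := w1_upper n hn s hs hns cns hcns hnorm
  have hn0 : (0:ℝ) < n := by exact_mod_cast hn
  refine ⟨n * (2 * ((n:ℝ) + 2) ^ 2 * C ^ 2), by positivity, ?_⟩
  intro x y hx hy
  have hK := PK_integrable n s cns hnorm y hy
  obtain ⟨X, hX⟩ : ∃ X, X = ‖x‖ ^ 2 + y ^ 2 := ⟨_, rfl⟩
  have hX0 : 0 < X := by rw [hX]; positivity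
  have hW := hw x y hy
  have hW0 : 0 ≤ w1 n s cns x y := by
    rw [w1_eq]
    have := CI_nonneg n s y hy x
    positivity
  have hi : ∀ i : Fin n, (pdX n (w1 n s cns) i x y) ^ 2
      ≤ 2 * ((n:ℝ) + 2) ^ 2 * C ^ 2 * X ^ (-((2 * ((n:ℝ) - 2*s) + 2) / 2)) := by
    intro i
    have h1 : pdX n (w1 n s cns) i x y
        = cns * y ^ (2*s) * fderiv ℝ (CI n s y) x (EuclideanSpace.single i 1) := by
      unfold pdX
      have : (fun x' => w1 n s cns x' y) = (cns * y ^ (2*s)) • (CI n s y) := by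
        ext x'
        rw [w1_eq]
        rfl
      rw [this, fderiv_const_smul_field]
      rfl
    have h2 := fderiv_coord n s hs hns y hy hK x hx i
    rw [← hX] at h2 hW
    have hxp : X ^ (-((2 * ((n:ℝ) - 2*s) + 2) / 2)) = (X ^ (-(((n:ℝ) - 2*s) / 2))) ^ 2 / X := by
      rw [← Real.rpow_natCast (X ^ _), ← Real.rpow_mul hX0.le, ← Real.rpow_sub_one hX0.ne']
      congr 1
      push_cast
      ring
    rw [h1, hxp, mul_pow]
    calc _ ≤ (cns * y ^ (2*s)) ^ 2 * (2 * ((n:ℝ) + 2) ^ 2 * (CI n s y x) ^ 2 / X) := by gcongr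
      _ = 2 * ((n:ℝ) + 2) ^ 2 * (w1 n s cns x y) ^ 2 / X := by rw [w1_eq]; ring
      _ ≤ 2 * ((n:ℝ) + 2) ^ 2 * (C * X ^ (-(((n:ℝ) - 2*s) / 2))) ^ 2 / X := by gcongr
      _ = _ := by ring
  rw [← hX]
  calc _ ≤ ∑ i : Fin n, 2 * ((n:ℝ) + 2) ^ 2 * C ^ 2 * X ^ (-((2 * ((n:ℝ) - 2*s) + 2) / 2)) :=
        Finset.sum_le_sum fun i _ => hi i
    _ = _ := by
      rw [Finset.sum_const, Finset.card_univ, Fintype.card_fin, nsmul_eq_mul]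
      ring

/-- Weighted gradient integrability of the standard bubble, supercritical weight
(inequality (3.6), case `σ > n - 2s`). -/
theorem bubble_weighted_integrable_supercritical
    (n : ℕ) (hn : 1 ≤ n) (s : ℝ) (hs : s ∈ Ioo (0:ℝ) 1) (hns : 2 * s < (n:ℝ))
    (cns : ℝ) (hcns : 0 < cns)
    (hnorm : ∀ y : ℝ, 0 < y →
      cns * (∫ x : Euc n, y ^ (2*s) * (‖x‖ ^ 2 + y ^ 2) ^ (-(((n:ℝ) + 2*s) / 2))) = 1)
    (σ : ℝ) (hσ : (n:ℝ) - 2*s < σ) :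
    ∃ C > (0:ℝ), ∀ R : ℝ, 2 ≤ R →
      (∫⁻ p in {p : Euc n × ℝ | 1 ≤ ‖p.1‖ ∧ 0 < p.2 ∧ ‖p.1‖ ^ 2 + p.2 ^ 2 ≤ R ^ 2},
          ENNReal.ofReal (p.2 ^ (1 - 2*s) * ‖p.1‖ ^ σ *
            ∑ i, (pdX n (w1 n s cns) i p.1 p.2) ^ 2))
        ≤ ENNReal.ofReal (C * R ^ (σ - ((n:ℝ) - 2*s))) := by
  obtain ⟨M, hM, hpt⟩ := pointwise n hn s hs hns cns hcns hnorm
  obtain ⟨hs0, hs1⟩ := hs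
  obtain ⟨C1, hC1, hin⟩ := inner_bound s (2 * ((n:ℝ) - 2*s) + 2) hs1 (by linarith)
  obtain ⟨C2, hC2, hball⟩ := ball_rpow n hn (σ + (2 - 2*s - (2 * ((n:ℝ) - 2*s) + 2))) (by linarith)
  obtain ⟨γ, hγ⟩ : ∃ γ, γ = 2 * ((n:ℝ) - 2*s) + 2 := ⟨_, rfl⟩
  rw [← hγ] at hpt hin hball
  refine ⟨M * C1 * C2 * 2 ^ (σ - ((n:ℝ) - 2*s)), by positivity, ?_⟩
  intro R hR
  have hR0 : 0 < R := by linarith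
  obtain ⟨hbi, hbb⟩ := hball (2 * R) (by positivity)
  have hxm : Measurable (fun x : Euc n => ‖x‖ ^ σ) := by fun_prop
  calc _ ≤ ∫⁻ p in {p : Euc n × ℝ | 1 ≤ ‖p.1‖ ∧ 0 < p.2 ∧ ‖p.1‖ ^ 2 + p.2 ^ 2 ≤ R ^ 2},
          ENNReal.ofReal (p.2 ^ (1 - 2*s) * ‖p.1‖ ^ σ *
            (M * (‖p.1‖ ^ 2 + p.2 ^ 2) ^ (-(γ / 2)))) := by
        refine setLIntegral_mono' ?_ ?_
        · have a1 : MeasurableSet {p : Euc n × ℝ | 1 ≤ ‖p.1‖} :=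
            measurableSet_le measurable_const (by fun_prop)
          have a2 : MeasurableSet {p : Euc n × ℝ | 0 < p.2} :=
            measurableSet_lt measurable_const (by fun_prop)
          have a3 : MeasurableSet {p : Euc n × ℝ | ‖p.1‖ ^ 2 + p.2 ^ 2 ≤ R ^ 2} :=
            measurableSet_le (by fun_prop) measurable_const
          exact a1.inter (a2.inter a3)
        · rintro ⟨x, y⟩ ⟨h1, h2, -⟩
          simp only at h1 h2 ⊢
          apply ENNReal.ofReal_le_ofReal
          refine mul_le_mul_of_nonneg_left (hpt x y ?_ h2) (by positivity)
          rintro rfl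
          simp at h1
          linarith
    _ ≤ ∫⁻ p in (Metric.ball (0 : Euc n) (2 * R) \ {0}) ×ˢ Ioi (0:ℝ),
          ENNReal.ofReal (p.2 ^ (1 - 2*s) * ‖p.1‖ ^ σ *
            (M * (‖p.1‖ ^ 2 + p.2 ^ 2) ^ (-(γ / 2)))) := by
        refine lintegral_mono_set ?_
        rintro ⟨x, y⟩ ⟨h1, h2, h3⟩
        simp only at h1 h2 h3
        refine ⟨⟨?_, ?_⟩, h2⟩
        · simp only [Metric.mem_ball, dist_zero_right]
          nlinarith [sq_nonneg y]
        · rintro rfl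
          simp at h1
          linarith
    _ = ∫⁻ x in Metric.ball (0 : Euc n) (2 * R) \ {0}, ∫⁻ y in Ioi (0:ℝ),
          ENNReal.ofReal (y ^ (1 - 2*s) * ‖x‖ ^ σ *
            (M * (‖x‖ ^ 2 + y ^ 2) ^ (-(γ / 2)))) := by
        rw [Measure.volume_eq_prod, ← Measure.prod_restrict, lintegral_prod]
        exact Measurable.aemeasurable (by fun_prop)
    _ ≤ ∫⁻ x in Metric.ball (0 : Euc n) (2 * R) \ {0},
          ENNReal.ofReal (M * C1 * ‖x‖ ^ (σ + (2 - 2*s - γ))) := by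
        refine setLIntegral_mono' (measurableSet_ball.diff (measurableSet_singleton _)) ?_
        intro x hx
        have hxp : 0 < ‖x‖ := norm_pos_iff.mpr hx.2
        calc _ = ∫⁻ y in Ioi (0:ℝ), ENNReal.ofReal (M * ‖x‖ ^ σ) *
              ENNReal.ofReal (y ^ (1 - 2*s) * (‖x‖ ^ 2 + y ^ 2) ^ (-(γ / 2))) := by
              congr 1
              ext y
              rw [← ENNReal.ofReal_mul (by positivity)]
              congr 1
              ring
          _ = ENNReal.ofReal (M * ‖x‖ ^ σ) * ∫⁻ y in Ioi (0:ℝ),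
              ENNReal.ofReal (y ^ (1 - 2*s) * (‖x‖ ^ 2 + y ^ 2) ^ (-(γ / 2))) :=
              lintegral_const_mul' _ _ ENNReal.ofReal_ne_top
          _ ≤ ENNReal.ofReal (M * ‖x‖ ^ σ) * ENNReal.ofReal (C1 * ‖x‖ ^ (2 - 2*s - γ)) := by
              gcongr
              exact hin _ hxp
          _ = _ := by
              rw [← ENNReal.ofReal_mul (by positivity), Real.rpow_add hxp]
              congr 1
              ring
    _ ≤ ∫⁻ x in Metric.ball (0 : Euc n) (2 * R),
          ENNReal.ofReal (M * C1 * ‖x‖ ^ (σ + (2 - 2*s - γ))) :=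
        lintegral_mono_set sdiff_subset
    _ = ENNReal.ofReal (∫ x in Metric.ball (0 : Euc n) (2 * R),
          M * C1 * ‖x‖ ^ (σ + (2 - 2*s - γ))) := by
        rw [ofReal_integral_eq_lintegral_ofReal (hbi.const_mul _)]
        filter_upwards with x
        positivity
    _ ≤ _ := by
        apply ENNReal.ofReal_le_ofReal
        rw [integral_const_mul]
        calc _ ≤ M * C1 * (C2 * (2 * R) ^ (σ + (2 - 2*s - γ) + n)) := by gcongr
          _ = _ := by
            rw [show σ + (2 - 2*s - γ) + n = σ - ((n:ℝ) - 2*s) by rw [hγ]; ring,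
              Real.mul_rpow (by norm_num) hR0.le]
            ring
end
end

section
/- Kernel estimate on the outer region (inequality (3.10)): For every δ with 0 < δ < n−2s there exists a constant C > 0, depending only on n, s and δ, such that for every x ∈ ℝⁿ ∖ {0}, every y > 0 and every index i ∈ {1,…,n}: | ∫_{{|ξ| > 3|x|/2}} y^{2s} (x_i − ξ_i) (y² + |x−ξ|²)^{−(n+2s)/2 − 1} (1 + |ξ|²)^{−(n−2s)/2} dξ | ≤ C y^{2s−1} |x|^{−δ} (y² + |x|²)^{−(n−δ)/2}. -/
open MeasureTheory Filter Set Topology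

noncomputable section

/-- Pointwise bound for the kernel, in terms of real quantities only. -/
lemma kernel_pointwise_aux (N s δ a r t y z : ℝ) (hs : 0 < s) (hNs : 2 * s < N)
    (hδ0 : 0 < δ) (hδ : δ < N - 2 * s) (ha : 0 < a) (hr : 3 * a / 2 < r)
    (ht : r - a ≤ t) (hy : 0 < y) (hz : |z| ≤ t) :
    |y ^ (2*s) * z * (y ^ 2 + t ^ 2) ^ (-((N + 2*s) / 2) - 1) *
        (1 + r ^ 2) ^ (-((N - 2*s) / 2))| ≤
      y ^ (2*s - 1) * ((1/4 : ℝ) ^ (-((N - δ) / 2)) * (y ^ 2 + a ^ 2) ^ (-((N - δ) / 2))) *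
        ((a / 5) ^ (-(N + δ)) * (1 + a⁻¹ * r) ^ (-(N + δ))) := by
  have ht0 : 0 < t := by linarith
  have hr0 : 0 < r := by linarith
  set Q := y ^ 2 + t ^ 2 with hQ
  have hQ0 : 0 < Q := by positivity
  set m := a / 5 * (1 + a⁻¹ * r) with hm
  have hm' : m = (a + r) / 5 := by rw [hm]; field_simp
  have hm0 : 0 < m := by rw [hm']; positivity
  have hmt : m ≤ t := by rw [hm']; linarith
  have hmr : m ≤ r := by rw [hm']; linarith
  have e1 : (a / 5) ^ (-(N + δ)) * (1 + a⁻¹ * r) ^ (-(N + δ)) = m ^ (-(N + δ)) := by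
    rw [hm, Real.mul_rpow (by positivity) (by positivity)]
  have e2 : (1/4 : ℝ) ^ (-((N - δ) / 2)) * (y ^ 2 + a ^ 2) ^ (-((N - δ) / 2)) =
      (1/4 * (y ^ 2 + a ^ 2)) ^ (-((N - δ) / 2)) := by
    rw [Real.mul_rpow (by positivity) (by positivity)]
  have e3 : m ^ (-(N + δ)) = (m^2) ^ (-((2*s + δ) / 2)) * (m^2) ^ (-((N - 2*s) / 2)) := by
    rw [← Real.rpow_add (by positivity), ← Real.rpow_natCast, ← Real.rpow_mul hm0.le]
    congr 1
    push_cast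
    ring
  have e4 : Q ^ (-((N + 2*s) / 2) - 1) =
      Q ^ (-((N - δ) / 2)) * Q ^ (-((2*s + δ) / 2)) * Q⁻¹ := by
    rw [← Real.rpow_neg_one, ← Real.rpow_add hQ0, ← Real.rpow_add hQ0]
    congr 1
    ring
  have e5 : y ^ (2*s) = y ^ (2*s - 1) * y := by
    rw [Real.rpow_sub_one hy.ne']
    field_simp
  have b1 : Q ^ (-((N - δ) / 2)) ≤ (1/4 * (y ^ 2 + a ^ 2)) ^ (-((N - δ) / 2)) := by
    apply Real.rpow_le_rpow_of_nonpos (by positivity) _ (by linarith)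
    rw [hQ]; nlinarith
  have b2 : Q ^ (-((2*s + δ) / 2)) ≤ (m^2) ^ (-((2*s + δ) / 2)) := by
    apply Real.rpow_le_rpow_of_nonpos (by positivity) _ (by linarith)
    rw [hQ]; nlinarith
  have b3 : (1 + r ^ 2) ^ (-((N - 2*s) / 2)) ≤ (m^2) ^ (-((N - 2*s) / 2)) := by
    apply Real.rpow_le_rpow_of_nonpos (by positivity) _ (by linarith)
    nlinarith
  have b4 : y * |z| * Q⁻¹ ≤ 1 := by
    rw [← div_eq_mul_inv, div_le_one hQ0, hQ]
    nlinarith [mul_le_mul_of_nonneg_left hz hy.le, sq_nonneg (y - t)]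
  rw [e1, e2, e3, e4, e5]
  have hA : 0 ≤ y ^ (2*s - 1) := by positivity
  rw [abs_mul, abs_mul, abs_mul, abs_of_nonneg (by positivity : 0 ≤ y ^ (2*s - 1) * y),
    abs_of_nonneg (by positivity : 0 ≤ Q ^ (-((N - δ) / 2)) * Q ^ (-((2*s + δ) / 2)) * Q⁻¹),
    abs_of_nonneg (by positivity : 0 ≤ (1 + r ^ 2) ^ (-((N - 2*s) / 2)))]
  calc _ = y ^ (2*s - 1) * Q ^ (-((N - δ) / 2)) *
        (Q ^ (-((2*s + δ) / 2)) * (1 + r ^ 2) ^ (-((N - 2*s) / 2))) * (y * |z| * Q⁻¹) := by ring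
    _ ≤ y ^ (2*s - 1) * Q ^ (-((N - δ) / 2)) *
        (Q ^ (-((2*s + δ) / 2)) * (1 + r ^ 2) ^ (-((N - 2*s) / 2))) * 1 := by gcongr
    _ ≤ _ := by rw [mul_one]; gcongr

/-- Kernel estimate on the outer region (inequality (3.10)). -/
theorem kernel_estimate_outer_region
    (n : ℕ) (hn : 1 ≤ n) (s : ℝ) (hs : s ∈ Ioo (0:ℝ) 1) (hns : 2 * s < (n:ℝ))
    (δ : ℝ) (hδ0 : 0 < δ) (hδ : δ < (n:ℝ) - 2*s) :
    ∃ C > (0:ℝ), ∀ x : Euc n, x ≠ 0 → ∀ y : ℝ, 0 < y → ∀ i : Fin n,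
      |∫ ξ in {ξ : Euc n | 3 * ‖x‖ / 2 < ‖ξ‖},
          y ^ (2*s) * (x i - ξ i) * (y ^ 2 + ‖x - ξ‖ ^ 2) ^ (-(((n:ℝ) + 2*s) / 2) - 1) *
            (1 + ‖ξ‖ ^ 2) ^ (-(((n:ℝ) - 2*s) / 2))|
        ≤ C * y ^ (2*s - 1) * ‖x‖ ^ (-δ) * (y ^ 2 + ‖x‖ ^ 2) ^ (-(((n:ℝ) - δ) / 2)) := by
  obtain ⟨hs0, hs1⟩ := hs
  set F : Euc n → ℝ := fun ξ => (1 + ‖ξ‖) ^ (-((n:ℝ) + δ)) with hF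
  have hFi : Integrable F := by
    apply integrable_one_add_norm
    simp [hδ0]
  have hF0 : ∀ ξ, 0 ≤ F ξ := fun ξ => by simp only [hF]; positivity
  set K : ℝ := ∫ ξ, F ξ with hK
  have hK0 : 0 ≤ K := integral_nonneg hF0
  set c : ℝ := (1/4 : ℝ) ^ (-(((n:ℝ) - δ) / 2)) * (1/5 : ℝ) ^ (-((n:ℝ) + δ)) with hc
  have hc0 : 0 < c := by positivity
  refine ⟨c * (K + 1), by positivity, ?_⟩
  intro x hx y hy i
  have ha : 0 < ‖x‖ := norm_pos_iff.mpr hx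
  set a := ‖x‖ with haeq
  set A : ℝ := y ^ (2*s - 1) * ((1/4 : ℝ) ^ (-(((n:ℝ) - δ) / 2)) *
    (y ^ 2 + a ^ 2) ^ (-(((n:ℝ) - δ) / 2))) * (a / 5) ^ (-((n:ℝ) + δ)) with hA
  have hA0 : 0 ≤ A := by positivity
  have hgi : Integrable (fun ξ : Euc n => A * F (a⁻¹ • ξ)) :=
    (hFi.comp_smul (inv_ne_zero ha.ne')).const_mul A
  have hmeas : MeasurableSet {ξ : Euc n | 3 * a / 2 < ‖ξ‖} :=
    measurableSet_lt measurable_const measurable_norm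
  have step1 := norm_integral_le_of_norm_le (μ := volume.restrict {ξ : Euc n | 3 * a / 2 < ‖ξ‖})
    (f := fun ξ : Euc n => y ^ (2*s) * (x i - ξ i) *
      (y ^ 2 + ‖x - ξ‖ ^ 2) ^ (-(((n:ℝ) + 2*s) / 2) - 1) *
            (1 + ‖ξ‖ ^ 2) ^ (-(((n:ℝ) - 2*s) / 2))) hgi.integrableOn (by
      filter_upwards [ae_restrict_mem hmeas] with ξ hξ
      have h := kernel_pointwise_aux n s δ a ‖ξ‖ ‖x - ξ‖ y (x i - ξ i) hs0 hns hδ0 hδ ha hξ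
        (by have := norm_sub_norm_le ξ x; rwa [norm_sub_rev] at this) hy
        (by simpa using PiLp.norm_apply_le (x - ξ) i)
      rw [Real.norm_eq_abs]
      refine h.trans (le_of_eq ?_)
      simp only [hA, hF, norm_smul, norm_inv, Real.norm_eq_abs, abs_of_pos ha]
      ring)
  rw [Real.norm_eq_abs] at step1
  refine step1.trans ?_
  have step2 : ∫ ξ in {ξ : Euc n | 3 * a / 2 < ‖ξ‖}, A * F (a⁻¹ • ξ) ≤
      ∫ ξ : Euc n, A * F (a⁻¹ • ξ) :=
    setIntegral_le_integral hgi (Eventually.of_forall fun ξ => mul_nonneg hA0 (hF0 _))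
  refine step2.trans ?_
  rw [integral_const_mul, Measure.integral_comp_inv_smul_of_nonneg volume F ha.le, ← hK,
    finrank_euclideanSpace_fin, smul_eq_mul]
  have e : (a / 5) ^ (-((n:ℝ) + δ)) * a ^ n = (1/5 : ℝ) ^ (-((n:ℝ) + δ)) * a ^ (-δ) := by
    rw [div_eq_mul_one_div, mul_comm a, Real.mul_rpow (by positivity) ha.le, mul_assoc,
      ← Real.rpow_natCast, ← Real.rpow_add ha]
    congr 2
    ring
  calc A * (a ^ n * K) = (c * K) * (y ^ (2*s - 1) * a ^ (-δ) *
        (y ^ 2 + a ^ 2) ^ (-(((n:ℝ) - δ) / 2))) := by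
        rw [hA, hc]
        linear_combination (y ^ (2*s - 1) * ((1/4 : ℝ) ^ (-(((n:ℝ) - δ) / 2)) *
          (y ^ 2 + a ^ 2) ^ (-(((n:ℝ) - δ) / 2))) * K) * e
    _ ≤ (c * (K + 1)) * (y ^ (2*s - 1) * a ^ (-δ) *
        (y ^ 2 + a ^ 2) ^ (-(((n:ℝ) - δ) / 2))) := by
        gcongr
        linarith
    _ = _ := by ring
end
end
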